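/- arXiv:2602.00530 — 2 statements merged into one kernel-verified Lean document; each statement's English description precedes it below -/
import Mathlib

section
/- Let L be a finite simple graph, C a longest cycle in L with a fixed orientation, and H a connected component of L − V(C). Then for every vertex u of H, both N_L(H)⁺ ∪ {u} and N_L(H)⁻ ∪ {u} are independent sets of vertices in L. -/
open SimpleGraph

/-- The successor, on the oriented cycle `C`, of the vertex in position `i`. -/
def cycSucc {V : Type*} {L : SimpleGraph V} {v : V} (C : L.Walk v v) (i : ℕ) : V :=
  C.getVert ((i + 1) % C.length)

/-- The predecessor, on the oriented cycle `C`, of the vertex in position `i`. -/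
def cycPred {V : Type*} {L : SimpleGraph V} {v : V} (C : L.Walk v v) (i : ℕ) : V :=
  C.getVert ((i + C.length - 1) % C.length)

/-- `N_L(H)`, for a component `H` of `L - V(C)`: the set of vertices of `C` with a
neighbour in `H`. -/
def compNbhd {V : Type*} (L : SimpleGraph V) {v : V} (C : L.Walk v v)
    (K : (L.induce {w | w ∉ C.support}).ConnectedComponent) : Set V :=
  {x | x ∈ C.support ∧ ∃ h : {w | w ∉ C.support},
    (L.induce {w | w ∉ C.support}).connectedComponentMk h = K ∧ L.Adj x h.1}

/-- `N_L(H)⁺`: the successors on `C` of the vertices of `N_L(H)`. -/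
def compNbhdSucc {V : Type*} (L : SimpleGraph V) {v : V} (C : L.Walk v v)
    (K : (L.induce {w | w ∉ C.support}).ConnectedComponent) : Set V :=
  {y | ∃ i : ℕ, i < C.length ∧ C.getVert i ∈ compNbhd L C K ∧ y = cycSucc C i}

/-- `N_L(H)⁻`: the predecessors on `C` of the vertices of `N_L(H)`. -/
def compNbhdPred {V : Type*} (L : SimpleGraph V) {v : V} (C : L.Walk v v)
    (K : (L.induce {w | w ∉ C.support}).ConnectedComponent) : Set V :=
  {y | ∃ i : ℕ, i < C.length ∧ C.getVert i ∈ compNbhd L C K ∧ y = cycPred C i}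

namespace SimpleGraph.Walk

variable {V : Type*} {L : SimpleGraph V}

theorem exists_eq_append_cons_of_mem_darts {a b : V} (p : L.Walk a b) {d : L.Dart}
    (hd : d ∈ p.darts) :
    ∃ (q : L.Walk a d.fst) (r : L.Walk d.snd b), p = q.append (cons d.adj r) := by
  induction p with
  | nil => simp at hd
  | cons h p ih =>
    rw [darts_cons, List.mem_cons] at hd
    rcases hd with rfl | hd
    · exact ⟨nil, p, rfl⟩
    · obtain ⟨q, r, rfl⟩ := ih hd
      exact ⟨cons h q, r, rfl⟩

/-- Deleting a dart from a cycle leaves a spanning path of the cycle. -/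
theorem IsCycle.exists_isPath_delete_dart {v : V} {C : L.Walk v v} (hC : C.IsCycle) {d : L.Dart}
    (hd : d ∈ C.darts) :
    ∃ T : L.Walk d.snd d.fst, T.IsPath ∧ T.length + 1 = C.length ∧
      T.support ⊆ C.support ∧ ∀ e ∈ C.darts, e = d ∨ e ∈ T.darts := by
  obtain ⟨q, r, rfl⟩ := C.exists_eq_append_cons_of_mem_darts hd
  refine ⟨r.append q, ?_, ?_, ?_, ?_⟩
  · have h := hC.support_nodup
    rw [tail_support_append, support_cons, List.tail_cons] at h
    rw [isPath_def, support_append]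
    exact (List.perm_append_comm.nodup_iff).1 h
  · simp only [length_append, length_cons]; omega
  · intro x
    simp only [mem_support_append_iff, support_cons, List.mem_cons]
    tauto
  · intro e
    simp only [darts_append, darts_cons, List.mem_append, List.mem_cons]
    tauto

/-- Two disjoint paths whose ends are joined by two edges close up to a cycle. -/
theorem IsPath.exists_isCycle_of_disjoint {a b h k : V} {P : L.Walk a b} {Q : L.Walk h k}
    (hP : P.IsPath) (hQ : Q.IsPath) (hlen : 0 < P.length) (hdisj : ∀ x ∈ Q.support, x ∉ P.support)
    (hbh : L.Adj b h) (hka : L.Adj k a) :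
    ∃ D : L.Walk k k, D.IsCycle ∧ D.length = P.length + Q.length + 2 := by
  refine ⟨cons hka (P.append (cons hbh Q)), ?_, by simp only [length_append, length_cons]; omega⟩
  have hab : a ≠ b := by
    rintro rfl
    exact hlen.ne' (length_eq_zero_iff.2 (isPath_iff_nil.1 hP))
  rw [cons_isCycle_iff]
  constructor
  · rw [isPath_def, support_append, support_cons, List.tail_cons, List.nodup_append']
    exact ⟨hP.support_nodup, hQ.support_nodup, fun x hx hx' => hdisj x hx' hx⟩
  · rw [edges_append, edges_cons, List.mem_append, List.mem_cons]
    rintro (h1 | h1 | h1)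
    · exact hdisj k Q.end_mem_support (P.fst_mem_support_of_mem_edges h1)
    · rw [Sym2.eq_iff] at h1
      rcases h1 with ⟨-, rfl⟩ | ⟨-, h1⟩
      · exact hdisj a Q.start_mem_support P.start_mem_support
      · exact hab h1
    · exact hdisj a (Q.snd_mem_support_of_mem_edges h1) P.start_mem_support

/-- If the first vertex of a path is adjacent to the head of one of its darts, then the part of
the path before that dart can be reversed. -/
theorem IsPath.exists_isPath_of_adj_snd {a b : V} {T : L.Walk a b} (hT : T.IsPath) {d : L.Dart}
    (hd : d ∈ T.darts) (hadj : L.Adj a d.snd) :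
    ∃ P : L.Walk d.fst b, P.IsPath ∧ P.length = T.length ∧ P.support ⊆ T.support := by
  obtain ⟨q, r, rfl⟩ := T.exists_eq_append_cons_of_mem_darts hd
  refine ⟨q.reverse.append (cons hadj r), ?_, by simp, ?_⟩
  · rw [isPath_def] at hT ⊢
    simp only [support_append, support_cons, List.tail_cons, support_reverse,
      List.nodup_append', List.nodup_reverse, List.disjoint_left, List.mem_reverse] at hT ⊢
    exact hT
  · intro x
    simp only [support_append, support_cons, List.tail_cons, support_reverse, List.mem_append,
      List.mem_reverse, imp_self]

theorem IsCycle.not_adj_snd_of_longest {v : V} {C : L.Walk v v} (hC : C.IsCycle)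
    (hmax : ∀ (u : V) (D : L.Walk u u), D.IsCycle → D.length ≤ C.length)
    {d : L.Dart} (hd : d ∈ C.darts) {h k : V} {Q : L.Walk h k}
    (hQ : Q.IsPath) (hQC : ∀ x ∈ Q.support, x ∉ C.support) (hdh : L.Adj d.fst h) :
    ¬ L.Adj d.snd k := by
  intro hadj
  obtain ⟨T, hT, hlen, hsub, -⟩ := hC.exists_isPath_delete_dart hd
  have := hC.three_le_length
  obtain ⟨D, hD, hDl⟩ := hT.exists_isCycle_of_disjoint hQ (by omega)
    (fun x hx hx' => hQC x hx (hsub hx')) hdh hadj.symm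
  have := hmax _ D hD
  omega

theorem IsCycle.not_adj_snd_snd_of_longest {v : V} {C : L.Walk v v} (hC : C.IsCycle)
    (hmax : ∀ (u : V) (D : L.Walk u u), D.IsCycle → D.length ≤ C.length)
    {d e : L.Dart} (hd : d ∈ C.darts) (he : e ∈ C.darts)
    {h k : V} {Q : L.Walk h k} (hQ : Q.IsPath) (hQC : ∀ x ∈ Q.support, x ∉ C.support)
    (hdh : L.Adj d.fst h) (hek : L.Adj e.fst k) : ¬ L.Adj d.snd e.snd := by
  intro hadj
  obtain ⟨T, hT, hlen, hsub, hdarts⟩ := hC.exists_isPath_delete_dart hd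
  rcases hdarts e he with rfl | he
  · exact hadj.ne rfl
  obtain ⟨P, hP, hPl, hPsub⟩ := hT.exists_isPath_of_adj_snd he hadj
  have := hC.three_le_length
  obtain ⟨D, hD, hDl⟩ := hP.exists_isCycle_of_disjoint hQ (by omega)
    (fun x hx hx' => hQC x hx (hsub (hPsub hx'))) hdh hek.symm
  have := hmax _ D hD
  omega

theorem exists_dart_getVert_succ {a b : V} (p : L.Walk a b) {i : ℕ} (hi : i < p.length) :
    ∃ d ∈ p.darts, d.fst = p.getVert i ∧ d.snd = p.getVert (i + 1) := by
  have hi' : i < p.darts.length := by simpa using hi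
  exact ⟨p.darts[i], List.getElem_mem hi', by simp [darts_getElem_eq_getVert]⟩

theorem getVert_mod_length {v : V} (C : L.Walk v v) {i : ℕ} (hi : i ≤ C.length) :
    C.getVert (i % C.length) = C.getVert i := by
  rcases hi.lt_or_eq with h | rfl
  · rw [Nat.mod_eq_of_lt h]
  · simp

end SimpleGraph.Walk

section Component

variable {V : Type*} {L : SimpleGraph V}

theorem exists_isPath_of_connectedComponentMk_eq {s : Set V} {h k : s}
    (hhk : (L.induce s).connectedComponentMk h = (L.induce s).connectedComponentMk k) :
    ∃ Q : L.Walk h k, Q.IsPath ∧ ∀ x ∈ Q.support, x ∈ s := by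
  obtain ⟨p, hp⟩ := (ConnectedComponent.exact hhk).exists_isPath
  refine ⟨p.map (Embedding.induce s).toHom, hp.map Subtype.val_injective, ?_⟩
  intro x hx
  obtain ⟨y, -, rfl⟩ := List.mem_map.1 ((p.support_map (Embedding.induce s).toHom) ▸ hx)
  exact y.2

variable {v : V} {C : L.Walk v v} {K : (L.induce {w | w ∉ C.support}).ConnectedComponent}

theorem exists_dart_of_mem_compNbhdSucc {y : V} (hy : y ∈ compNbhdSucc L C K) :
    ∃ d ∈ C.darts, d.fst ∈ compNbhd L C K ∧ d.snd = y := by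
  obtain ⟨i, hi, hK, rfl⟩ := hy
  obtain ⟨d, hd, hfst, hsnd⟩ := C.exists_dart_getVert_succ hi
  exact ⟨d, hd, hfst ▸ hK, by rw [hsnd, cycSucc, C.getVert_mod_length hi]⟩

theorem exists_dart_of_mem_compNbhdPred {y : V} (hy : y ∈ compNbhdPred L C K) :
    ∃ d ∈ C.darts, d.snd ∈ compNbhd L C K ∧ d.fst = y := by
  obtain ⟨i, hi, hK, rfl⟩ := hy
  rcases i with _ | i
  · obtain ⟨d, hd, hfst, hsnd⟩ := C.exists_dart_getVert_succ (i := C.length - 1) (by omega)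
    refine ⟨d, hd, ?_, ?_⟩
    · rw [hsnd, Nat.sub_add_cancel (by omega)]
      simpa using hK
    · rw [hfst, cycPred, C.getVert_mod_length (by omega), Nat.zero_add]
  · obtain ⟨d, hd, hfst, hsnd⟩ := C.exists_dart_getVert_succ (i := i) (by omega)
    refine ⟨d, hd, hsnd ▸ hK, ?_⟩
    rw [hfst, cycPred, show i + 1 + C.length - 1 = i + C.length by omega, Nat.add_mod_right,
      C.getVert_mod_length (by omega)]

/-- Let `C'` be a longest cycle on vertices of `C`. If every vertex of `S` succeeds on `C'` a
neighbour of the component `K`, then `S` together with any vertex of `K` is independent. -/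
theorem indep_of_forall_exists_dart {v' : V} {C' : L.Walk v' v'} (hC' : C'.IsCycle)
    (hmax : ∀ (u : V) (D : L.Walk u u), D.IsCycle → D.length ≤ C'.length)
    (hsupp : ∀ x ∈ C'.support, x ∈ C.support) {S : Set V}
    (hS : ∀ y ∈ S, ∃ d ∈ C'.darts, d.fst ∈ compNbhd L C K ∧ d.snd = y)
    (u : {w | w ∉ C.support})
    (hu : (L.induce {w | w ∉ C.support}).connectedComponentMk u = K) :
    ∀ a ∈ S ∪ {(u : V)}, ∀ b ∈ S ∪ {(u : V)}, ¬ L.Adj a b := by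
  have hSu : ∀ a ∈ S, ¬ L.Adj a u := by
    intro a ha
    obtain ⟨d, hd, ⟨-, h, hh, hdh⟩, rfl⟩ := hS a ha
    obtain ⟨Q, hQ, hQC⟩ := exists_isPath_of_connectedComponentMk_eq (hh.trans hu.symm)
    exact hC'.not_adj_snd_of_longest hmax hd hQ (fun x hx hx' => hQC x hx (hsupp x hx')) hdh
  rintro a (ha | rfl) b (hb | rfl)
  · obtain ⟨d, hd, ⟨-, h, hh, hdh⟩, rfl⟩ := hS a ha
    obtain ⟨e, he, ⟨-, k, hk, hek⟩, rfl⟩ := hS b hb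
    obtain ⟨Q, hQ, hQC⟩ := exists_isPath_of_connectedComponentMk_eq (hh.trans hk.symm)
    exact hC'.not_adj_snd_snd_of_longest hmax hd he hQ
      (fun x hx hx' => hQC x hx (hsupp x hx')) hdh hek
  · exact hSu a ha
  · exact fun hadj => hSu b hb hadj.symm
  · exact L.irrefl

end Component


/-- Let `C` be a longest cycle of `L` and `H` a connected component of `L - V(C)`.
For every vertex `u` of `H`, both `N_L(H)⁺ ∪ {u}` and `N_L(H)⁻ ∪ {u}` are
independent sets in `L`. -/
theorem compNbhdSucc_union_indep {V : Type*} [Fintype V] (L : SimpleGraph V)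
    {v : V} (C : L.Walk v v) (hC : C.IsCycle)
    (hmax : ∀ (u : V) (D : L.Walk u u), D.IsCycle → D.length ≤ C.length)
    (K : (L.induce {w | w ∉ C.support}).ConnectedComponent)
    (u : {w | w ∉ C.support})
    (hu : (L.induce {w | w ∉ C.support}).connectedComponentMk u = K) :
    (∀ a ∈ compNbhdSucc L C K ∪ {(u : V)}, ∀ b ∈ compNbhdSucc L C K ∪ {(u : V)},
      ¬ L.Adj a b) ∧
    (∀ a ∈ compNbhdPred L C K ∪ {(u : V)}, ∀ b ∈ compNbhdPred L C K ∪ {(u : V)},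
      ¬ L.Adj a b) := by
  refine ⟨indep_of_forall_exists_dart hC hmax (fun _ hx => hx)
      (fun _ => exists_dart_of_mem_compNbhdSucc) u hu,
    indep_of_forall_exists_dart (C' := C.reverse) hC.reverse (by simpa using hmax) (by simp)
      (fun y hy => ?_) u hu⟩
  obtain ⟨d, hd, hK, rfl⟩ := exists_dart_of_mem_compNbhdPred hy
  exact ⟨d.symm, by simpa using hd, hK, rfl⟩
end

section
/- Let L be a finite simple graph, C a longest cycle in L with a fixed orientation, and x a vertex of L not on C all of whose neighbours lie on C; let x_i and x_j be two distinct neighbours of x. Suppose w and w⁺ are consecutive vertices on the segment of C from x_i to x_j following the orientation. Then for each assignment of {z, z'} = {x_i⁻, x_j⁺}, at least one of wz and w⁺z' is not an edge of L. -/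
open SimpleGraph

namespace SimpleGraph

variable {V : Type*} {L : SimpleGraph V}

theorem exists_isPath_of_injOn_of_adj (g : ℕ → V) (k : ℕ) (hinj : Set.InjOn g {i | i ≤ k})
    (hadj : ∀ i, i < k → L.Adj (g i) (g (i + 1))) :
    ∃ p : L.Walk (g 0) (g k), p.IsPath ∧ p.length = k ∧ ∀ y ∈ p.support, ∃ i ≤ k, g i = y := by
  induction k with
  | zero => exact ⟨.nil, by simp⟩
  | succ k ih =>
    obtain ⟨p, hp, hlen, hsupp⟩ := ih
      (hinj.mono fun i (hi : i ≤ k) ↦ show i ≤ k + 1 by lia) fun i hi ↦ hadj i (by lia)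
    refine ⟨p.concat (hadj k (by lia)), hp.concat (fun hmem ↦ ?_) _, by simp [hlen], ?_⟩
    · obtain ⟨i, hi, heq⟩ := hsupp _ hmem
      have := hinj (show i ≤ k + 1 by lia) (show k + 1 ≤ k + 1 by lia) heq
      lia
    · intro y hy
      simp only [Walk.support_concat, List.mem_append, List.mem_singleton] at hy
      rcases hy with hy | rfl
      · obtain ⟨i, hi, heq⟩ := hsupp _ hy
        exact ⟨i, by lia, heq⟩
      · exact ⟨k + 1, le_rfl, rfl⟩

/-- A path on `n ≥ 2` vertices whose two ends are both adjacent to a vertex `x` off the path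
closes up to a cycle of length `n + 1`. -/
theorem exists_isCycle_of_injOn_of_adj (g : ℕ → V) {n : ℕ} (hn : 2 ≤ n)
    (hinj : Set.InjOn g {i | i < n}) (hadj : ∀ i, i + 1 < n → L.Adj (g i) (g (i + 1)))
    {x : V} (hx : ∀ i < n, g i ≠ x) (hfirst : L.Adj x (g 0)) (hlast : L.Adj x (g (n - 1))) :
    ∃ D : L.Walk x x, D.IsCycle ∧ D.length = n + 1 := by
  obtain ⟨p, hp, hlen, hsupp⟩ := exists_isPath_of_injOn_of_adj (L := L) g (n - 1)
    (hinj.mono fun i (hi : i ≤ n - 1) ↦ show i < n by lia) fun i hi ↦ hadj i (by lia)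
  refine ⟨.cons hfirst (p.concat hlast.symm), ?_, by simp [hlen]; lia⟩
  rw [Walk.isCycle_iff_isPath_tail_and_le_length]
  refine ⟨?_, by simp [hlen]; lia⟩
  rw [Walk.isPath_def, Walk.support_tail_of_not_nil _ Walk.not_nil_cons]
  refine (hp.concat (fun hmem ↦ ?_) _).support_nodup
  obtain ⟨i, hi, heq⟩ := hsupp _ hmem
  exact hx i (by lia) heq

/-- Traverse `c 0, …, c s`, then `c (n - 1), …, c (m + 1)` backwards, then
`c (s + 1), …, c m`, and return through `x`. -/
theorem exists_isCycle_of_adj_pred_of_adj_succ (c : ℕ → V) {n s m : ℕ} (hsm : s < m)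
    (hmn : m + 1 < n) (hinj : Set.InjOn c {i | i < n})
    (hadj : ∀ i, i + 1 < n → L.Adj (c i) (c (i + 1)))
    {x : V} (hx : ∀ i < n, c i ≠ x) (hfirst : L.Adj x (c 0)) (hlast : L.Adj x (c m))
    (hpred : L.Adj (c s) (c (n - 1))) (hsucc : L.Adj (c (s + 1)) (c (m + 1))) :
    ∃ D : L.Walk x x, D.IsCycle ∧ D.length = n + 1 := by
  let σ : ℕ → ℕ := fun i ↦ if i ≤ s then i else if i < s + n - m then n + s - i else i + m + 1 - n
  have hσ (i : ℕ) :
      σ i = if i ≤ s then i else if i < s + n - m then n + s - i else i + m + 1 - n := rfl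
  have hσn (i : ℕ) (hi : i < n) : σ i < n := by rw [hσ]; split_ifs <;> lia
  refine exists_isCycle_of_injOn_of_adj (fun i ↦ c (σ i)) (by lia) ?_ ?_
    (fun i hi ↦ hx _ (hσn i hi)) ?_ ?_
  · intro i hi j hj hij
    have hi' : i < n := hi
    have hj' : j < n := hj
    have := hinj (hσn i hi) (hσn j hj) hij
    rw [hσ, hσ] at this
    split_ifs at this <;> lia
  · intro i hi
    rcases lt_trichotomy i s with h | rfl | h
    · convert hadj i hi using 2 <;> rw [hσ] <;> split_ifs <;> lia
    · convert hpred using 2 <;> rw [hσ] <;> split_ifs <;> lia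
    · rcases lt_trichotomy (i + 1) (s + n - m) with h' | h' | h'
      · convert (hadj (n + s - (i + 1)) (by lia)).symm using 2 <;> rw [hσ] <;> split_ifs <;> lia
      · convert hsucc.symm using 2 <;> rw [hσ] <;> split_ifs <;> lia
      · convert hadj (i + m + 1 - n) (by lia) using 2 <;> rw [hσ] <;> split_ifs <;> lia
  · simpa [hσ] using hfirst
  · convert hlast using 2
    rw [hσ]
    split_ifs <;> lia

/-- Traverse `c 0, …, c s`, then `c (m + 1), …, c (n - 1)`, then `c (s + 1), …, c m`, and
return through `x`. -/
theorem exists_isCycle_of_adj_succ_of_adj_pred (c : ℕ → V) {n s m : ℕ} (hsm : s < m)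
    (hmn : m + 1 < n) (hinj : Set.InjOn c {i | i < n})
    (hadj : ∀ i, i + 1 < n → L.Adj (c i) (c (i + 1)))
    {x : V} (hx : ∀ i < n, c i ≠ x) (hfirst : L.Adj x (c 0)) (hlast : L.Adj x (c m))
    (hsucc : L.Adj (c s) (c (m + 1))) (hpred : L.Adj (c (s + 1)) (c (n - 1))) :
    ∃ D : L.Walk x x, D.IsCycle ∧ D.length = n + 1 := by
  let σ : ℕ → ℕ := fun i ↦ if i ≤ s then i else if i < s + n - m then i + m - s else i + m + 1 - n
  have hσ (i : ℕ) :
      σ i = if i ≤ s then i else if i < s + n - m then i + m - s else i + m + 1 - n := rfl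
  have hσn (i : ℕ) (hi : i < n) : σ i < n := by rw [hσ]; split_ifs <;> lia
  refine exists_isCycle_of_injOn_of_adj (fun i ↦ c (σ i)) (by lia) ?_ ?_
    (fun i hi ↦ hx _ (hσn i hi)) ?_ ?_
  · intro i hi j hj hij
    have hi' : i < n := hi
    have hj' : j < n := hj
    have := hinj (hσn i hi) (hσn j hj) hij
    rw [hσ, hσ] at this
    split_ifs at this <;> lia
  · intro i hi
    rcases lt_trichotomy i s with h | rfl | h
    · convert hadj i hi using 2 <;> rw [hσ] <;> split_ifs <;> lia
    · convert hsucc using 2 <;> rw [hσ] <;> split_ifs <;> lia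
    · rcases lt_trichotomy (i + 1) (s + n - m) with h' | h' | h'
      · convert hadj (i + m - s) (by lia) using 2 <;> rw [hσ] <;> split_ifs <;> lia
      · convert hpred.symm using 2 <;> rw [hσ] <;> split_ifs <;> lia
      · convert hadj (i + m + 1 - n) (by lia) using 2 <;> rw [hσ] <;> split_ifs <;> lia
  · simpa [hσ] using hfirst
  · convert hlast using 2
    rw [hσ]
    split_ifs <;> lia

theorem Walk.adj_getVert_mod {v : V} (C : L.Walk v v) (hC : 0 < C.length) (k : ℕ) :
    L.Adj (C.getVert (k % C.length)) (C.getVert ((k + 1) % C.length)) := by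
  have hk := Nat.mod_lt k hC
  have hadj := C.adj_getVert_succ hk
  rcases Nat.lt_or_ge (k % C.length + 1) C.length with h | h
  · rwa [← Nat.mod_add_mod, Nat.mod_eq_of_lt h]
  · have h' : k % C.length + 1 = C.length := by lia
    rw [← Nat.mod_add_mod, h', Nat.mod_self, Walk.getVert_zero]
    rwa [h', Walk.getVert_length] at hadj

theorem Walk.IsCycle.injOn_getVert_add_mod {v : V} {C : L.Walk v v} (hC : C.IsCycle) (a : ℕ) :
    Set.InjOn (fun i ↦ C.getVert ((a + i) % C.length)) {i | i < C.length} := by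
  intro i hi j hj hij
  have hpos : 0 < C.length := Nat.zero_lt_of_lt hi
  have hlt (k : ℕ) : (a + k) % C.length ≤ C.length - 1 := by
    have := Nat.mod_lt (a + k) hpos
    lia
  have hmod : a + i ≡ a + j [MOD C.length] := hC.getVert_injOn' (hlt i) (hlt j) hij
  exact (Nat.ModEq.add_left_cancel' a hmod).eq_of_lt_of_lt hi hj

end SimpleGraph

theorem add_add_sub_mod_mod {a b n : ℕ} (ha : a < n) (hb : b < n) :
    (a + (b + n - a) % n) % n = b := by
  rw [Nat.add_mod_mod, show a + (b + n - a) = b + n by lia, Nat.add_mod_right,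
    Nat.mod_eq_of_lt hb]

/-- Let `C` be a longest cycle of `L` and `x` a vertex off `C` all of whose neighbours
lie on `C`; let `x_i = C.getVert a` and `x_j = C.getVert b` be distinct neighbours of
`x`, and let `w = C.getVert t` and `w⁺` be consecutive vertices on the segment of `C`
from `x_i` to `x_j` following the orientation. Then for each assignment
`{z, z'} = {x_i⁻, x_j⁺}`, at least one of `wz` and `w⁺z'` is not an edge of `L`. -/
theorem longest_cycle_segment_edge {V : Type*} [Fintype V] (L : SimpleGraph V)
    {v : V} (C : L.Walk v v) (hC : C.IsCycle)
    (hmax : ∀ (u : V) (D : L.Walk u u), D.IsCycle → D.length ≤ C.length)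
    (x : V) (hx : x ∉ C.support) (hnbrs : ∀ w : V, L.Adj x w → w ∈ C.support)
    (a b : ℕ) (ha : a < C.length) (hb : b < C.length)
    (hxa : L.Adj x (C.getVert a)) (hxb : L.Adj x (C.getVert b))
    (hab : (b + C.length - a) % C.length ≠ 0)
    (t : ℕ) (ht : t < C.length)
    (hseg : (t + C.length - a) % C.length < (b + C.length - a) % C.length) :
    (¬ L.Adj (C.getVert t) (cycPred C a) ∨ ¬ L.Adj (cycSucc C t) (cycSucc C b)) ∧
    (¬ L.Adj (C.getVert t) (cycSucc C b) ∨ ¬ L.Adj (cycSucc C t) (cycPred C a)) := by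
  have hpos : 0 < C.length := by lia
  set n := C.length with hn
  set m := (b + n - a) % n with hm
  set s := (t + n - a) % n with hs
  have hmn : m < n := Nat.mod_lt _ hpos
  have hbm : (a + m) % n = b := add_add_sub_mod_mod ha hb
  have hts : (a + s) % n = t := add_add_sub_mod_mod ha ht
  let c : ℕ → V := fun i ↦ C.getVert ((a + i) % n)
  have hinj : Set.InjOn c {i | i < n} := hC.injOn_getVert_add_mod a
  have hadj (i : ℕ) (_ : i + 1 < n) : L.Adj (c i) (c (i + 1)) := C.adj_getVert_mod hpos (a + i)
  have hxc (i : ℕ) (_ : i < n) : c i ≠ x := fun h ↦ hx (h ▸ C.getVert_mem_support _)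
  have hc0 : c 0 = C.getVert a := by simp [c, Nat.mod_eq_of_lt ha]
  have hcm : c m = C.getVert b := by simp [c, hbm]
  have hcs : c s = C.getVert t := by simp [c, hts]
  have hcs' : c (s + 1) = cycSucc C t := by
    simp only [c, cycSucc, ← hn]
    rw [← add_assoc, ← Nat.mod_add_mod, hts]
  have hcm' : c (m + 1) = cycSucc C b := by
    simp only [c, cycSucc, ← hn]
    rw [← add_assoc, ← Nat.mod_add_mod, hbm]
  have hcn : c (n - 1) = cycPred C a := by
    simp only [c, cycPred, ← hn]
    rw [Nat.add_sub_assoc hpos]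
  rw [← hc0] at hxa
  rw [← hcm] at hxb
  rw [← hcs, ← hcs', ← hcm', ← hcn]
  have hno : ¬ ∃ D : L.Walk x x, D.IsCycle ∧ D.length = n + 1 := by
    rintro ⟨D, hD, hlen⟩
    have := hmax x D hD
    lia
  have hmn' : m + 1 < n := by
    by_contra h
    have hm' : m = n - 1 := by lia
    exact hno (exists_isCycle_of_injOn_of_adj c (by lia) hinj hadj hxc hxa (hm' ▸ hxb))
  simp only [← not_and_or]
  exact ⟨fun ⟨h₁, h₂⟩ ↦ hno
      (exists_isCycle_of_adj_pred_of_adj_succ c hseg hmn' hinj hadj hxc hxa hxb h₁ h₂),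
    fun ⟨h₁, h₂⟩ ↦ hno
      (exists_isCycle_of_adj_succ_of_adj_pred c hseg hmn' hinj hadj hxc hxa hxb h₁ h₂)⟩
end
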